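/- Let 5 ≤ N ≤ 7. Then ∫_{ℝ^N} V_ε(x)² log(V_ε(x)²) dx = −((N−4)/2) c_N ω_N ε^{(N−4)/2} log(1/ε) ∫₀^{2ρ} g(r)² r^{7−N} dr + O(ε^{(N−4)/2}) as ε → 0⁺, where c_N = (N(N−4)(N²−4))^{(N−4)/4} and ω_N is the surface area of the unit sphere in ℝ^N. -/

import Mathlib

open MeasureTheory Real Filter Asymptotics
open scoped Topology

/-- The Euclidean Laplacian: sum of second partial derivatives in the
coordinate directions. -/
noncomputable def lapl {N : ℕ} (u : EuclideanSpace ℝ (Fin N) → ℝ)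
    (x : EuclideanSpace ℝ (Fin N)) : ℝ :=
  ∑ i : Fin N, fderiv ℝ (fun y => fderiv ℝ u y (EuclideanSpace.single i 1)) x
    (EuclideanSpace.single i 1)

/-- The function `u_ε(x) = [N(N−4)(N²−4)ε²]^{(N−4)/8} / (ε + |x|²)^{(N−4)/2}`. -/
noncomputable def bubble (N : ℕ) (ε : ℝ) (x : EuclideanSpace ℝ (Fin N)) : ℝ :=
  ((N : ℝ) * ((N : ℝ) - 4) * ((N : ℝ) ^ 2 - 4) * ε ^ 2) ^ (((N : ℝ) - 4) / 8) /
    (ε + ‖x‖ ^ 2) ^ (((N : ℝ) - 4) / 2)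

/-- The truncated function `V_ε(x) = g(|x|) u_ε(x)`. -/
noncomputable def cutBubble (N : ℕ) (g : ℝ → ℝ) (ε : ℝ)
    (x : EuclideanSpace ℝ (Fin N)) : ℝ :=
  g ‖x‖ * bubble N ε x

/-- The surface area of the unit sphere in `ℝ^N`, i.e. `N` times the volume of
the unit ball. -/
noncomputable def sphereArea (N : ℕ) : ℝ :=
  (N : ℝ) * (volume (Metric.ball (0 : EuclideanSpace ℝ (Fin N)) 1)).toReal

lemma log_one_div_mul_div_add_sq_le {ε r : ℝ} (hε : 0 < ε) (hr : 0 < r) :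
    Real.log (1 / ε) * (ε / (ε + r ^ 2)) ≤ 4 * r ^ (-(1 / 2) : ℝ) := by
  obtain ⟨s, hs, rfl⟩ : ∃ s : ℝ, 0 < s ∧ ε = s ^ 4 :=
    ⟨√√ε, by positivity, by
      rw [show (4 : ℕ) = 2 * 2 from rfl, pow_mul, Real.sq_sqrt (by positivity),
        Real.sq_sqrt hε.le]⟩
  obtain ⟨t, ht, rfl⟩ : ∃ t : ℝ, 0 < t ∧ r = t ^ 2 :=
    ⟨√r, by positivity, (Real.sq_sqrt hr.le).symm⟩
  have hpow : (t ^ 2) ^ (-(1 / 2) : ℝ) = 1 / t := by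
    rw [Real.rpow_neg (by positivity), ← Real.sqrt_eq_rpow, Real.sqrt_sq ht.le, one_div]
  have hlog : Real.log (1 / s ^ 4) ≤ 4 * (1 / s) := by
    rw [← one_div_pow, Real.log_pow]
    have := Real.log_le_self (show (0 : ℝ) ≤ 1 / s by positivity)
    push_cast
    linarith
  have hst : s ^ 3 * t ≤ s ^ 4 + t ^ 4 := by
    rcases le_total s t with h | h
    · have : s ^ 3 * t ≤ t ^ 3 * t := by gcongr
      nlinarith [pow_pos hs 4]
    · have : s ^ 3 * t ≤ s ^ 3 * s := by gcongr
      nlinarith [pow_pos ht 4]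
  rw [hpow]
  calc Real.log (1 / s ^ 4) * (s ^ 4 / (s ^ 4 + (t ^ 2) ^ 2))
      ≤ 4 * (1 / s) * (s ^ 4 / (s ^ 4 + (t ^ 2) ^ 2)) := by gcongr
    _ = 4 * (s ^ 3 / (s ^ 4 + t ^ 4)) := by
      field_simp
    _ ≤ 4 * (1 / t) := by
      refine mul_le_mul_of_nonneg_left ?_ (by norm_num)
      rw [div_le_div_iff₀ (by positivity) ht]
      linarith

lemma abs_log_add_sq_le {ε r R : ℝ} (hε : 0 < ε) (hε1 : ε ≤ 1) (hr : 0 < r) (hrR : r ≤ R) :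
    |Real.log (ε + r ^ 2)| ≤ 2 * |Real.log r| + Real.log (1 + R ^ 2) := by
  have hL : 0 ≤ Real.log (1 + R ^ 2) := Real.log_nonneg (by nlinarith)
  have hupper : Real.log (ε + r ^ 2) ≤ Real.log (1 + R ^ 2) := by
    gcongr
  have hlower : Real.log (r ^ 2) ≤ Real.log (ε + r ^ 2) :=
    Real.log_le_log (by positivity) (by linarith)
  rw [Real.log_pow] at hlower
  push_cast at hlower
  rw [abs_le]
  constructor <;> nlinarith [neg_abs_le (Real.log r), abs_nonneg (Real.log r)]

/-- Pointwise expansion of the radial density of `V² log V²`, with a remainder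
bounded by an integrable function of the radius that does not depend on `ε`. -/
lemma abs_radial_mul_log_add_le {n : ℕ} (hn : n ≤ 3) {a K R ε r G : ℝ} (ha : 0 ≤ a)
    (hK : 0 < K) (hε : 0 < ε) (hε1 : ε ≤ 1) (hr : 0 < r) (hrR : r ≤ R)
    (hG : G ∈ Set.Icc (0 : ℝ) 1) :
    |r ^ (n + 3) * (G ^ 2 * (K * ε ^ a / (ε + r ^ 2) ^ n) *
          Real.log (G ^ 2 * (K * ε ^ a / (ε + r ^ 2) ^ n)))
        + a * K * ε ^ a * Real.log (1 / ε) * (G ^ 2 * r ^ (3 - n))| ≤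
      ε ^ a * (K * (1 + R) ^ 3 *
        (1 + |Real.log K| + n * (2 + Real.log (1 + R ^ 2)) + 4 * n * a) *
          (1 + |Real.log r| + r ^ (-(1 / 2) : ℝ))) := by
  obtain ⟨hG0, hG1⟩ := hG
  have hR : 0 < R := hr.trans_le hrR
  have hL : 0 ≤ Real.log (1 + R ^ 2) := Real.log_nonneg (by nlinarith)
  have hεa : 0 < ε ^ a := Real.rpow_pos_of_pos hε a
  have hw : 0 < r ^ (-(1 / 2) : ℝ) := Real.rpow_pos_of_pos hr _
  have hd : 0 < ε + r ^ 2 := by positivity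
  rcases hG0.eq_or_lt with rfl | hGpos
  · simp only [ne_eq, OfNat.ofNat_ne_zero, not_false_eq_true, zero_pow, zero_mul, mul_zero,
      add_zero, abs_zero]
    positivity
  set q : ℝ := r ^ 2 / (ε + r ^ 2) with hq
  have hq0 : 0 ≤ q := by positivity
  have hq1 : q ≤ 1 := by
    rw [hq, div_le_one hd]; linarith
  have hqε : 1 - q = ε / (ε + r ^ 2) := by
    rw [hq]; field_simp; ring
  have hqn0 : 0 ≤ q ^ n := by positivity
  have hqn1 : q ^ n ≤ 1 := pow_le_one₀ hq0 hq1
  have hbern : 1 - q ^ n ≤ n * (ε / (ε + r ^ 2)) := by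
    have := one_add_mul_le_pow (a := q - 1) (by linarith) n
    rw [← hqε]
    have h2 : 1 + (q - 1) = q := by ring
    rw [h2] at this
    linarith
  have hlog : Real.log (G ^ 2 * (K * ε ^ a / (ε + r ^ 2) ^ n)) =
      Real.log (G ^ 2) + Real.log K - a * Real.log (1 / ε) - n * Real.log (ε + r ^ 2) := by
    rw [Real.log_mul (by positivity) (by positivity), Real.log_div (by positivity) (by positivity),
      Real.log_mul hK.ne' hεa.ne', Real.log_rpow hε, Real.log_pow (n := n), one_div, Real.log_inv]
    ring
  have hpow : r ^ (n + 3) = r ^ (3 - n) * (r ^ 2) ^ n := by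
    rw [← pow_mul, ← pow_add]; congr 1; omega
  have hsplit : r ^ (n + 3) * (G ^ 2 * (K * ε ^ a / (ε + r ^ 2) ^ n) *
          Real.log (G ^ 2 * (K * ε ^ a / (ε + r ^ 2) ^ n)))
        + a * K * ε ^ a * Real.log (1 / ε) * (G ^ 2 * r ^ (3 - n)) =
      ε ^ a * (K * r ^ (3 - n) *
        (q ^ n * (Real.log (G ^ 2) * G ^ 2 + G ^ 2 * Real.log K
            - G ^ 2 * (n * Real.log (ε + r ^ 2)))
          + a * G ^ 2 * (Real.log (1 / ε) * (1 - q ^ n)))) := by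
    rw [hlog, hpow, hq, div_pow]
    field_simp
    ring
  have hG2 : G ^ 2 ≤ 1 := pow_le_one₀ hG0 hG1
  have hG20 : 0 < G ^ 2 := by positivity
  have hGlog : |Real.log (G ^ 2) * G ^ 2| ≤ 1 := (Real.abs_log_mul_self_lt _ hG20 hG2).le
  have hlogε : 0 ≤ Real.log (1 / ε) := Real.log_nonneg (by rw [le_div_iff₀ hε]; linarith)
  have hrpow : r ^ (3 - n) ≤ (1 + R) ^ 3 :=
    calc r ^ (3 - n) ≤ (1 + R) ^ (3 - n) := by gcongr; linarith
      _ ≤ (1 + R) ^ 3 := pow_le_pow_right₀ (by linarith) (by omega)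
  have hfirst : |q ^ n * (Real.log (G ^ 2) * G ^ 2 + G ^ 2 * Real.log K
      - G ^ 2 * (n * Real.log (ε + r ^ 2)))| ≤
      1 + |Real.log K| + n * (2 * |Real.log r| + Real.log (1 + R ^ 2)) := by
    rw [abs_mul, abs_of_nonneg hqn0]
    refine (mul_le_of_le_one_left (abs_nonneg _) hqn1).trans ?_
    refine (abs_sub _ _).trans (add_le_add ((abs_add_le _ _).trans (add_le_add hGlog ?_)) ?_)
    · rw [abs_mul, abs_of_pos hG20]
      exact mul_le_of_le_one_left (abs_nonneg _) hG2
    · rw [abs_mul, abs_of_pos hG20]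
      refine (mul_le_of_le_one_left (abs_nonneg _) hG2).trans ?_
      rw [abs_mul, abs_of_nonneg (Nat.cast_nonneg n)]
      gcongr
      exact abs_log_add_sq_le hε hε1 hr hrR
  have hsecond : |a * G ^ 2 * (Real.log (1 / ε) * (1 - q ^ n))| ≤
      a * (n * (4 * r ^ (-(1 / 2) : ℝ))) := by
    have h1 : 0 ≤ 1 - q ^ n := by linarith
    rw [abs_of_nonneg (by positivity), mul_assoc]
    refine mul_le_mul_of_nonneg_left ?_ ha
    refine (mul_le_of_le_one_left (by positivity) hG2).trans ?_
    calc Real.log (1 / ε) * (1 - q ^ n)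
        ≤ Real.log (1 / ε) * (n * (ε / (ε + r ^ 2))) := by gcongr
      _ = n * (Real.log (1 / ε) * (ε / (ε + r ^ 2))) := by ring
      _ ≤ n * (4 * r ^ (-(1 / 2) : ℝ)) := by
        exact mul_le_mul_of_nonneg_left (log_one_div_mul_div_add_sq_le hε hr)
          (Nat.cast_nonneg n)
  rw [hsplit, abs_mul, abs_of_pos hεa, abs_mul, abs_of_pos (by positivity : 0 < K * r ^ (3 - n))]
  rw [mul_assoc (K * (1 + R) ^ 3)]
  gcongr
  refine ((abs_add_le _ _).trans (add_le_add hfirst hsecond)).trans ?_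
  have e1 : 0 ≤ (1 + |Real.log K|) * (|Real.log r| + r ^ (-(1 / 2) : ℝ)) := by positivity
  have e2 : 0 ≤ (n : ℝ) * 2 * (1 + r ^ (-(1 / 2) : ℝ)) := by positivity
  have e3 : 0 ≤ n * Real.log (1 + R ^ 2) * (|Real.log r| + r ^ (-(1 / 2) : ℝ)) := by positivity
  have e4 : 0 ≤ 4 * (n : ℝ) * a * (1 + |Real.log r|) := by positivity
  linarith

lemma cutBubble_sq (n : ℕ) (hn : 0 < n) (g : ℝ → ℝ) {ε : ℝ} (hε : 0 < ε)
    (x : EuclideanSpace ℝ (Fin (n + 4))) :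
    cutBubble (n + 4) g ε x ^ 2 =
      g ‖x‖ ^ 2 * ((((n : ℝ) + 4) * n * (((n : ℝ) + 4) ^ 2 - 4)) ^ ((n : ℝ) / 4) *
        ε ^ ((n : ℝ) / 2) / (ε + ‖x‖ ^ 2) ^ n) := by
  have hn' : (0 : ℝ) < n := by exact_mod_cast hn
  have hA : 0 < ((n : ℝ) + 4) * n * (((n : ℝ) + 4) ^ 2 - 4) := by
    have : (0 : ℝ) < ((n : ℝ) + 4) ^ 2 - 4 := by nlinarith
    positivity
  have hd : 0 < ε + ‖x‖ ^ 2 := by positivity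
  unfold cutBubble bubble
  push_cast
  rw [add_sub_cancel_right, mul_pow, div_pow, ← Real.rpow_mul_natCast (by positivity),
    ← Real.rpow_mul_natCast hd.le, Real.mul_rpow hA.le (by positivity),
    ← Real.rpow_natCast_mul hε.le, ← Real.rpow_natCast (ε + ‖x‖ ^ 2) n]
  rw [show (n : ℝ) / 8 * (2 : ℕ) = n / 4 by push_cast; ring,
    show ((2 : ℕ) : ℝ) * (n / 4) = n / 2 by push_cast; ring,
    show (n : ℝ) / 2 * (2 : ℕ) = n by push_cast; ring]

lemma intervalIntegrable_one_add_abs_log_add_rpow (R : ℝ) :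
    IntervalIntegrable (fun r : ℝ => 1 + |Real.log r| + r ^ (-(1 / 2) : ℝ)) volume 0 R :=
  (intervalIntegrable_const.add intervalIntegral.intervalIntegrable_log'.abs).add
    (intervalIntegral.intervalIntegrable_rpow' (by norm_num))

/-- For `5 ≤ N ≤ 7`:
`∫ V_ε² log(V_ε²) = −((N−4)/2) c_N ω_N ε^{(N−4)/2} log(1/ε) ∫₀^{2ρ} g(r)² r^{7−N} dr
 + O(ε^{(N−4)/2})` as `ε → 0⁺`, where `c_N = (N(N−4)(N²−4))^{(N−4)/4}` and `ω_N` is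
the area of the unit sphere in `ℝ^N`.
(Here `Real.log 0 = 0`, so the integrand is `0` wherever `V_ε = 0`.) -/
theorem cutBubble_log_estimate_low_dim (N : ℕ) (hN : 5 ≤ N) (hN' : N ≤ 7)
    (ρ : ℝ) (hρ : 0 < ρ)
    (g : ℝ → ℝ) (hg : ContDiff ℝ (⊤ : ℕ∞) g)
    (hg01 : ∀ r : ℝ, 0 ≤ r → g r ∈ Set.Icc (0 : ℝ) 1)
    (hg1 : ∀ r : ℝ, 0 ≤ r → r ≤ ρ → g r = 1)
    (hg0 : ∀ r : ℝ, 2 * ρ ≤ r → g r = 0)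
    (cN : ℝ)
    (hcN : cN = ((N : ℝ) * ((N : ℝ) - 4) * ((N : ℝ) ^ 2 - 4)) ^ (((N : ℝ) - 4) / 4)) :
    (fun ε : ℝ =>
        (∫ x : EuclideanSpace ℝ (Fin N),
            (cutBubble N g ε x) ^ 2 * Real.log ((cutBubble N g ε x) ^ 2))
          - (-(((N : ℝ) - 4) / 2) * cN * sphereArea N * ε ^ (((N : ℝ) - 4) / 2)
              * Real.log (1 / ε) * ∫ r in (0 : ℝ)..(2 * ρ), g r ^ 2 * r ^ (7 - N)))
      =O[𝓝[>] (0 : ℝ)] (fun ε : ℝ => ε ^ (((N : ℝ) - 4) / 2)) := by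
  obtain ⟨n, rfl⟩ : ∃ n, N = n + 4 := ⟨N - 4, by omega⟩
  have hn : 0 < n := by omega
  have hn3 : n ≤ 3 := by omega
  have hn' : (0 : ℝ) < n := by exact_mod_cast hn
  have hK : 0 < cN := by
    rw [hcN]
    apply Real.rpow_pos_of_pos
    push_cast
    have : (0 : ℝ) < ((n : ℝ) + 4) ^ 2 - 4 := by nlinarith
    rw [add_sub_cancel_right]
    positivity
  push_cast at hcN ⊢
  rw [add_sub_cancel_right] at hcN ⊢
  set a : ℝ := (n : ℝ) / 2 with ha
  have ha0 : 0 ≤ a := by positivity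
  set R : ℝ := 2 * ρ with hR
  have hR0 : 0 ≤ R := by positivity
  set C : ℝ := cN * (1 + R) ^ 3 *
    (1 + |Real.log cN| + n * (2 + Real.log (1 + R ^ 2)) + 4 * n * a)
  have hg' : Continuous g := hg.continuous
  refine IsBigO.of_bound (|sphereArea (n + 4)| *
    (∫ r in (0 : ℝ)..R, C * (1 + |Real.log r| + r ^ (-(1 / 2) : ℝ)))) ?_
  filter_upwards [Ioc_mem_nhdsGT (zero_lt_one : (0 : ℝ) < 1)] with ε hε
  obtain ⟨hε0, hε1⟩ := hε
  have hεa : 0 < ε ^ a := Real.rpow_pos_of_pos hε0 a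
  set W : ℝ → ℝ := fun r => g r ^ 2 * (cN * ε ^ a / (ε + r ^ 2) ^ n) with hW
  have hWc : Continuous W := by
    refine (hg'.pow 2).mul (continuous_const.div (by fun_prop) fun r => ?_)
    positivity
  have hWlog : Continuous fun r => r ^ (n + 3) * (W r * Real.log (W r)) :=
    (continuous_pow _).mul (Real.continuous_mul_log.comp hWc)
  have hpolar : ∫ x : EuclideanSpace ℝ (Fin (n + 4)),
      (cutBubble (n + 4) g ε x) ^ 2 * Real.log ((cutBubble (n + 4) g ε x) ^ 2) =
      sphereArea (n + 4) * ∫ r in (0 : ℝ)..R, r ^ (n + 3) * (W r * Real.log (W r)) := by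
    have hrad : ∀ x : EuclideanSpace ℝ (Fin (n + 4)), (cutBubble (n + 4) g ε x) ^ 2 = W ‖x‖ := by
      intro x
      rw [cutBubble_sq n hn g hε0 x, hW, hcN]
    simp_rw [hrad]
    rw [integral_fun_norm_addHaar volume (fun r => W r * Real.log (W r)),
      intervalIntegral.integral_of_le hR0,
      ← setIntegral_eq_of_subset_of_forall_sdiff_eq_zero measurableSet_Ioi
        (Set.Ioc_subset_Ioi_self : Set.Ioc 0 R ⊆ Set.Ioi 0)]
    · simp only [finrank_euclideanSpace, Fintype.card_fin, smul_eq_mul, nsmul_eq_mul, sphereArea,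
        Measure.real, show n + 4 - 1 = n + 3 by omega]
      ring
    · rintro r ⟨hr0, hr⟩
      have : R ≤ r := by
        by_contra! h
        exact hr ⟨hr0, h.le⟩
      simp [hW, hg0 r this]
  have hmain : Continuous fun r => a * cN * ε ^ a * Real.log (1 / ε) * (g r ^ 2 * r ^ (3 - n)) := by
    fun_prop
  have hdiff : (∫ x : EuclideanSpace ℝ (Fin (n + 4)),
        (cutBubble (n + 4) g ε x) ^ 2 * Real.log ((cutBubble (n + 4) g ε x) ^ 2))
      - (-a * cN * sphereArea (n + 4) * ε ^ a * Real.log (1 / ε) *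
          ∫ r in (0 : ℝ)..R, g r ^ 2 * r ^ (3 - n)) =
      sphereArea (n + 4) * ∫ r in (0 : ℝ)..R, (r ^ (n + 3) * (W r * Real.log (W r)) +
        a * cN * ε ^ a * Real.log (1 / ε) * (g r ^ 2 * r ^ (3 - n))) := by
    rw [hpolar, intervalIntegral.integral_add (hWlog.intervalIntegrable _ _)
      (hmain.intervalIntegrable _ _), intervalIntegral.integral_const_mul]
    ring
  rw [hdiff, norm_mul, Real.norm_eq_abs (sphereArea _), mul_assoc |sphereArea _|, Real.norm_of_nonneg hεa.le,
    mul_comm (∫ r in (0 : ℝ)..R, _) (ε ^ a), ← intervalIntegral.integral_const_mul]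
  gcongr
  refine intervalIntegral.norm_integral_le_of_norm_le hR0 (Eventually.of_forall fun r hr => ?_)
    (((intervalIntegrable_one_add_abs_log_add_rpow R).const_mul C).const_mul (ε ^ a))
  exact abs_radial_mul_log_add_le hn3 ha0 hK hε0 hε1 hr.1 hr.2 (hg01 r hr.1.le)
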